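/- (Existence and uniqueness of the ability threshold.) Fix σ > 0, τ ∈ (0,1), and a real constant c. Then there exists a unique real number μ_k satisfying the fixed-point equation μ_k = log(τ/(1-τ)) + σ²/2 + log((1 - Φ((μ_k - σ²)/σ)) / Φ(μ_k/σ)) - c, where Φ is the standard normal cumulative distribution function. -/

import Mathlib

open Real MeasureTheory

/-- The probability density function of the standard normal distribution. -/
noncomputable def stdNormalPDF (x : ℝ) : ℝ :=
  (Real.sqrt (2 * Real.pi))⁻¹ * Real.exp (-x ^ 2 / 2)

/-- The cumulative distribution function of the standard normal distribution. -/
noncomputable def stdNormalCDF (x : ℝ) : ℝ :=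
  ∫ t in Set.Iic x, stdNormalPDF t

lemma stdNormalPDF_eq_gaussianPDFReal :
    stdNormalPDF = ProbabilityTheory.gaussianPDFReal 0 1 := by
  ext x
  simp [stdNormalPDF, ProbabilityTheory.gaussianPDFReal]

lemma stdNormalPDF_pos (x : ℝ) : 0 < stdNormalPDF x := by
  unfold stdNormalPDF
  positivity

lemma integrable_stdNormalPDF : Integrable stdNormalPDF := by
  rw [stdNormalPDF_eq_gaussianPDFReal]
  exact ProbabilityTheory.integrable_gaussianPDFReal 0 1

lemma stdNormalCDF_sub (x y : ℝ) :
    stdNormalCDF y - stdNormalCDF x = ∫ t in x..y, stdNormalPDF t :=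
  intervalIntegral.integral_Iic_sub_Iic integrable_stdNormalPDF.integrableOn
    integrable_stdNormalPDF.integrableOn

lemma continuous_stdNormalCDF : Continuous stdNormalCDF := by
  have h : stdNormalCDF = fun y => stdNormalCDF 0 + ∫ t in (0 : ℝ)..y, stdNormalPDF t := by
    ext y
    linarith [stdNormalCDF_sub 0 y]
  rw [h]
  exact continuous_const.add (intervalIntegral.continuous_primitive
    (fun _ _ => integrable_stdNormalPDF.intervalIntegrable) 0)

lemma strictMono_stdNormalCDF : StrictMono stdNormalCDF := by
  intro x y hxy
  rw [← sub_pos, stdNormalCDF_sub]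
  exact intervalIntegral.intervalIntegral_pos_of_pos
    integrable_stdNormalPDF.intervalIntegrable stdNormalPDF_pos hxy

lemma stdNormalCDF_pos (x : ℝ) : 0 < stdNormalCDF x :=
  (integral_nonneg fun t => (stdNormalPDF_pos t).le).trans_lt
    (strictMono_stdNormalCDF (sub_one_lt x))

lemma stdNormalCDF_lt_one (x : ℝ) : stdNormalCDF x < 1 := by
  refine (strictMono_stdNormalCDF (lt_add_one x)).trans_le ?_
  calc stdNormalCDF (x + 1) ≤ ∫ t, stdNormalPDF t :=
        setIntegral_le_integral integrable_stdNormalPDF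
          (Filter.Eventually.of_forall fun t => (stdNormalPDF_pos t).le)
    _ = 1 := by
        rw [stdNormalPDF_eq_gaussianPDFReal]
        exact ProbabilityTheory.integral_gaussianPDFReal_eq_one 0 one_ne_zero

/-- A continuous antitone self-map of the real line has exactly one fixed point. -/
lemma Antitone.existsUnique_eq_self {f : ℝ → ℝ} (hf : Antitone f) (hc : Continuous f) :
    ∃! x, x = f x := by
  have hsub : Continuous fun x => x - f x := continuous_id.sub hc
  obtain ⟨x, hx⟩ := mem_range_of_exists_le_of_exists_ge (c := 0) hsub
    ⟨-|f 0|, by linarith [hf (neg_nonpos.2 (abs_nonneg (f 0))), neg_abs_le (f 0)]⟩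
    ⟨|f 0|, by linarith [hf (abs_nonneg (f 0)), le_abs_self (f 0)]⟩
  refine ⟨x, sub_eq_zero.1 hx, fun y hy => ?_⟩
  have hx' : x = f x := sub_eq_zero.1 hx
  rcases le_total x y with h | h <;> linarith [hf h]

/-- Existence and uniqueness of the data-investment-ability threshold `μ_k`, defined by the
fixed-point equation `μ_k = log(τ/(1-τ)) + σ²/2 + log((1 - Φ((μ_k - σ²)/σ)) / Φ(μ_k/σ)) - c`. -/
theorem threshold_exists_unique (σ τ c : ℝ) (hσ : 0 < σ) (hτ : τ ∈ Set.Ioo (0 : ℝ) 1) :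
    ∃! μk : ℝ, μk = Real.log (τ / (1 - τ)) + σ ^ 2 / 2
      + Real.log ((1 - stdNormalCDF ((μk - σ ^ 2) / σ)) / stdNormalCDF (μk / σ)) - c := by
  have hnum (x : ℝ) : 0 < 1 - stdNormalCDF ((x - σ ^ 2) / σ) :=
    sub_pos.2 (stdNormalCDF_lt_one _)
  have hden (x : ℝ) : 0 < stdNormalCDF (x / σ) := stdNormalCDF_pos _
  apply Antitone.existsUnique_eq_self
  · intro x y hxy
    have hnum_le : 1 - stdNormalCDF ((y - σ ^ 2) / σ) ≤ 1 - stdNormalCDF ((x - σ ^ 2) / σ) :=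
      sub_le_sub_left (strictMono_stdNormalCDF.monotone (by gcongr)) 1
    have hden_le : stdNormalCDF (x / σ) ≤ stdNormalCDF (y / σ) :=
      strictMono_stdNormalCDF.monotone (by gcongr)
    have hlog := Real.log_le_log (div_pos (hnum y) (hden y))
      (div_le_div₀ (hnum x).le hnum_le (hden x) hden_le)
    dsimp only
    linarith
  · have hΦ := continuous_stdNormalCDF
    have hquot : Continuous fun x : ℝ =>
        (1 - stdNormalCDF ((x - σ ^ 2) / σ)) / stdNormalCDF (x / σ) :=
      Continuous.div (by fun_prop) (by fun_prop) fun x => (hden x).ne'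
    exact (continuous_const.add
      (hquot.log fun x => (div_pos (hnum x) (hden x)).ne')).sub continuous_const
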